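/- Let A := sgn Q(0) + sgn Q(2π/3) + sgn Q(4π/3) as a bounded operator on L²(ℝ). Then the operator norm of A is strictly less than 3. -/

import Mathlib

open MeasureTheory Complex Real
open scoped InnerProductSpace ComplexConjugate

noncomputable section

/-- The complex Hilbert space `L²(ℝ, ℂ)`. -/
abbrev L2 : Type := Lp ℂ 2 (volume : Measure ℝ)

/-- `F` is the Fourier–Plancherel unitary operator on `L²(ℝ)`,
with convention `(Fψ)(p) = (2π)^{-1/2} ∫ e^{-ipq} ψ(q) dq`
(this property on the dense subspace `L¹ ∩ L²` determines `F` uniquely). -/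
def IsFourier (F : L2 ≃ₗᵢ[ℂ] L2) : Prop :=
  ∀ ψ : L2, Integrable (⇑ψ) volume →
    (F ψ : ℝ → ℂ) =ᵐ[volume]
      fun p : ℝ => (((2 * π) ^ (-(1:ℝ)/2) : ℝ) : ℂ) *
        ∫ q : ℝ, Complex.exp (-(Complex.I) * (p : ℂ) * (q : ℂ)) * ψ q

/-- `T` is the bounded multiplication operator `M_g` by `g` on `L²(ℝ)`. -/
def IsMulOp (g : ℝ → ℂ) (T : L2 →L[ℂ] L2) : Prop :=
  ∀ ψ : L2, (T ψ : ℝ → ℂ) =ᵐ[volume] fun q => g q * ψ q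

/-- `T = sgn P := 𝓕⁻¹ ∘ M_sgn ∘ 𝓕`. -/
def IsSgnP (T : L2 →L[ℂ] L2) : Prop :=
  ∃ F : L2 ≃ₗᵢ[ℂ] L2, IsFourier F ∧
    ∀ ψ : L2, (F (T ψ) : ℝ → ℂ) =ᵐ[volume]
      fun p => ((Real.sign p : ℝ) : ℂ) * (F ψ : ℝ → ℂ) p

/-- `χ_t(q) = exp(−(i/2)(cot t) q²)`. -/
def chi (t q : ℝ) : ℂ :=
  Complex.exp (-(Complex.I / 2) * ((Real.cos t / Real.sin t : ℝ) : ℂ) * (q : ℂ) ^ 2)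

/-- `T = sgn Q(t)`: for `t = 0` this is `M_sgn`, and for `sin t ≠ 0` it is
`sgn(sin t) · M_{χ_t} ∘ (sgn P) ∘ M_{χ_t}⁻¹`, which realizes `sgn(Q cos t + P sin t)`. -/
def IsSgnQ (t : ℝ) (T : L2 →L[ℂ] L2) : Prop :=
  if t = 0 then IsMulOp (fun q => ((Real.sign q : ℝ) : ℂ)) T
  else ∃ P Mc Mci : L2 →L[ℂ] L2, IsSgnP P ∧ IsMulOp (chi t) Mc ∧
    IsMulOp (fun q => (chi t q)⁻¹) Mci ∧
    T = (((Real.sign (Real.sin t) : ℝ) : ℂ) • (Mc ∘L P ∘L Mci))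

open Filter Topology Set

lemma norm_sq_eq_integral (f : L2) : ‖f‖ ^ 2 = ∫ x, ‖f x‖ ^ 2 := by
  have h := @inner_self_eq_norm_sq_to_K ℂ L2 _ _ _ f
  rw [L2.inner_def] at h
  have : (∫ x, ⟪f x, f x⟫_ℂ) = ((∫ x, ‖f x‖ ^ 2 : ℝ) : ℂ) := by
    rw [← integral_complex_ofReal]
    congr 1; ext x
    rw [inner_self_eq_norm_sq_to_K]; simp
  rw [this] at h
  have h' := Complex.ofReal_injective (h.trans (Complex.ofReal_pow _ _).symm)
  exact h'.symm

lemma integrable_norm_sq (f : L2) : Integrable (fun x => ‖f x‖ ^ 2) :=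
  (memLp_two_iff_integrable_sq_norm (Lp.memLp f).1).1 (Lp.memLp f)

lemma exists_isMulOp {g : ℝ → ℂ} (hg : AEStronglyMeasurable g volume) (C : ℝ)
    (hC : ∀ x, ‖g x‖ ≤ C) : ∃ T : L2 →L[ℂ] L2, IsMulOp g T := by
  have hm : MemLp g ⊤ volume := memLp_top_of_bound hg C (.of_forall hC)
  refine ⟨(ContinuousLinearMap.mul ℂ ℂ).holderL volume ⊤ 2 2 hm.toLp, fun ψ => ?_⟩
  have h := (ContinuousLinearMap.mul ℂ ℂ).coeFn_holder (r := 2) hm.toLp ψ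
  filter_upwards [h, hm.coeFn_toLp] with x hx hy
  simp only [ContinuousLinearMap.holderL_apply_apply]
  rw [hx, hy]; rfl

lemma exists_truncation (f : L2) : ∃ g : ℕ → L2, (∀ n, Integrable (g n)) ∧
    (∀ n, g n =ᵐ[volume] (Icc (-(n : ℝ)) n).indicator f) ∧ Tendsto g atTop (𝓝 f) := by
  have hm : ∀ n : ℕ, MemLp ((Icc (-(n : ℝ)) n).indicator f) 2 volume :=
    fun n => (Lp.memLp f).indicator measurableSet_Icc
  refine ⟨fun n => (hm n).toLp, fun n => ?_, fun n => (hm n).coeFn_toLp, ?_⟩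
  · rw [integrable_congr (hm n).coeFn_toLp, integrable_indicator_iff measurableSet_Icc]
    exact ((Lp.memLp f).restrict _).integrable (by norm_num)
  · rw [tendsto_iff_norm_sub_tendsto_zero]
    have h : Tendsto (fun n : ℕ => ‖(hm n).toLp - f‖ ^ 2) atTop (𝓝 0) := by
      have h0 : (0 : ℝ) = ∫ _ : ℝ, (0 : ℝ) := by simp
      have : ∀ n : ℕ, ‖(hm n).toLp - f‖ ^ 2
          = ∫ x, ‖(Icc (-(n : ℝ)) n).indicator f x - f x‖ ^ 2 := fun n => by
        rw [norm_sq_eq_integral]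
        refine integral_congr_ae ?_
        filter_upwards [Lp.coeFn_sub (hm n).toLp f, (hm n).coeFn_toLp] with x h1 h2
        rw [h1, Pi.sub_apply, h2]
      simp_rw [this]
      rw [h0]
      refine tendsto_integral_of_dominated_convergence (fun x => ‖f x‖ ^ 2)
        (fun n => (((hm n).sub (Lp.memLp f)).1.norm.pow 2)) (integrable_norm_sq f) ?_ ?_
      · intro n
        refine .of_forall fun x => ?_
        by_cases hx : x ∈ Icc (-(n : ℝ)) n <;> simp [hx]
      · refine .of_forall fun x => ?_
        obtain ⟨N, hN⟩ := exists_nat_ge |x|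
        refine tendsto_const_nhds.congr' ?_
        filter_upwards [eventually_ge_atTop N] with n hn
        have : x ∈ Icc (-(n : ℝ)) n :=
          abs_le.1 (hN.trans (by exact_mod_cast hn))
        simp [this]
    have := h.sqrt
    simpa using this

/-- The isometry `f ↦ f (c - ·)` of `L²(ℝ)`. -/
def reflection (c : ℝ) : L2 →ₗᵢ[ℂ] L2 :=
  Lp.compMeasurePreservingₗᵢ ℂ (fun x => c - x) (volume.measurePreserving_sub_left c)

lemma coeFn_reflection (c : ℝ) (f : L2) :
    (reflection c f : ℝ → ℂ) =ᵐ[volume] fun x => f (c - x) :=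
  Lp.coeFn_compMeasurePreserving f (volume.measurePreserving_sub_left c)

lemma ae_sub_left {p : ℝ → Prop} (c : ℝ) (h : ∀ᵐ x, p x) : ∀ᵐ x, p (c - x) :=
  (volume.measurePreserving_sub_left c).quasiMeasurePreserving.ae h

lemma IsMulOp.norm_apply {g : ℝ → ℂ} {T : L2 →L[ℂ] L2} (h : IsMulOp g T)
    (hg : ∀ᵐ x, ‖g x‖ = 1) (f : L2) : ‖T f‖ = ‖f‖ := by
  have : ‖T f‖ ^ 2 = ‖f‖ ^ 2 := by
    rw [norm_sq_eq_integral, norm_sq_eq_integral]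
    refine integral_congr_ae ?_
    filter_upwards [h f, hg] with x h1 h2
    rw [h1, norm_mul, h2, one_mul]
  exact (sq_eq_sq₀ (norm_nonneg _) (norm_nonneg _)).1 this

/-- The Fourier transform turns reflection about `c / 2` followed by a modulation into the
corresponding reflection in frequency space. -/
lemma IsFourier.apply_modulated_reflection {F : L2 ≃ₗᵢ[ℂ] L2} (hF : IsFourier F) (c q : ℝ)
    {V W : L2 →L[ℂ] L2} (hV : IsMulOp (fun x => exp (I * q * x)) V)
    (hW : IsMulOp (fun p => exp (-I * (p - q) * c)) W) (f : L2) :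
    F (V (reflection c f)) = W (reflection q (F f)) := by
  obtain ⟨g, hgi, -, hgt⟩ := exists_truncation f
  have h1 : Tendsto (fun n => F (V (reflection c (g n)))) atTop
      (𝓝 (F (V (reflection c f)))) :=
    ((F.continuous.comp (V.continuous.comp (reflection c).continuous)).tendsto f).comp hgt
  have h2 : Tendsto (fun n => W (reflection q (F (g n)))) atTop
      (𝓝 (W (reflection q (F f)))) :=
    ((W.continuous.comp ((reflection q).continuous.comp F.continuous)).tendsto f).comp hgt
  refine tendsto_nhds_unique h1 (h2.congr fun n => ?_)
  have hVn : (V (reflection c (g n)) : ℝ → ℂ) =ᵐ[volume]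
      fun x => exp (I * q * x) * g n (c - x) := by
    filter_upwards [hV (reflection c (g n)), coeFn_reflection c (g n)] with x hx hy
    rw [hx, hy]
  have hi : Integrable (V (reflection c (g n))) := by
    rw [integrable_congr hVn]
    refine ((hgi n).comp_sub_left c).bdd_mul (c := 1) (by fun_prop) (.of_forall fun x => ?_)
    rw [norm_exp]; simp
  ext1
  filter_upwards [hF _ hi, hW (reflection q (F (g n))), coeFn_reflection q (F (g n)),
    ae_sub_left q (hF _ (hgi n))] with p h3 h4 h5 h6
  rw [h3, h4, h5, h6]
  have e1 : ∫ x : ℝ, exp (-I * p * x) * V (reflection c (g n)) x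
      = ∫ x : ℝ, exp (-I * p * x) * (exp (I * q * x) * g n (c - x)) := by
    refine integral_congr_ae ?_
    filter_upwards [hVn] with x hx
    rw [hx]
  have e2 := integral_sub_left_eq_self
    (fun x : ℝ => exp (-I * p * (c - x : ℝ)) * (exp (I * q * (c - x : ℝ)) * g n x)) volume c
  rw [e1]
  simp only [sub_sub_cancel] at e2
  rw [e2, mul_left_comm]
  congr 1
  rw [← integral_const_mul]
  congr 1; ext x
  rw [← mul_assoc, ← mul_assoc, ← Complex.exp_add, ← Complex.exp_add]
  congr 2
  push_cast; ring

/-- If `F f` lives on negative frequencies, then the Wigner function of `f` vanishes at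
positive frequencies. -/
lemma IsFourier.integral_conj_mul_reflection_eq_zero {F : L2 ≃ₗᵢ[ℂ] L2} (hF : IsFourier F)
    {f : L2} (hf : ∀ᵐ p, 0 < p → F f p = 0) (c : ℝ) {q : ℝ} (hq : 0 < q) :
    ∫ x : ℝ, conj (f x) * (exp (I * q * x) * f (c - x)) = 0 := by
  obtain ⟨V, hV⟩ := exists_isMulOp (g := fun x : ℝ => exp (I * q * x)) (by fun_prop) 1
    (fun x => by rw [norm_exp]; simp)
  obtain ⟨W, hW⟩ := exists_isMulOp (g := fun p : ℝ => exp (-I * (p - q) * c)) (by fun_prop) 1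
    (fun x => by rw [norm_exp]; simp)
  have h1 : ⟪f, V (reflection c f)⟫_ℂ = ∫ x : ℝ, conj (f x) * (exp (I * q * x) * f (c - x)) := by
    rw [L2.inner_def]
    refine integral_congr_ae ?_
    filter_upwards [hV (reflection c f), coeFn_reflection c f] with x hx hy
    rw [hx, hy, RCLike.inner_apply']
  rw [← h1, ← F.inner_map_map, hF.apply_modulated_reflection c q hV hW, L2.inner_def]
  refine integral_eq_zero_of_ae ?_
  filter_upwards [hW (reflection q (F f)), coeFn_reflection q (F f), hf, ae_sub_left q hf]
    with p h2 h3 h4 h5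
  rw [h2, h3]
  rcases lt_or_ge 0 p with hp | hp
  · simp [h4 hp]
  · simp [h5 (by linarith)]

/-- The convolution kernel of the Fourier multiplier with symbol `ρ`. -/
def multiplierKernel (ρ : ℝ → ℝ) (t : ℝ) : ℂ :=
  (2 * π : ℂ)⁻¹ * ∫ p : ℝ, (ρ p : ℂ) * exp (I * p * t)

lemma integrable_kernel_mul {k : ℝ → ℂ} (hk : Integrable k) (f g : L2) :
    Integrable (fun z : ℝ × ℝ => k (z.1 - z.2) * (conj (f z.1) * g z.2)) := by
  have h2 : Integrable (fun z : ℝ × ℝ => ‖g z.2‖ ^ 2 * ‖k (z.1 - z.2)‖) :=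
    (integrable_norm_sq g).convolution_integrand (ContinuousLinearMap.mul ℝ ℝ) hk.norm
  have h1 : Integrable (fun z : ℝ × ℝ => ‖f z.1‖ ^ 2 * ‖k (z.1 - z.2)‖) := by
    have := ((integrable_norm_sq f).convolution_integrand (ContinuousLinearMap.mul ℝ ℝ)
      hk.comp_neg.norm).swap
    refine this.congr (.of_forall fun z => ?_)
    simp
  have hkm : AEStronglyMeasurable (fun z : ℝ × ℝ => k (z.1 - z.2)) :=
    hk.1.comp_quasiMeasurePreserving
      (quasiMeasurePreserving_sub_of_right_invariant volume volume)
  refine (h1.add h2).mono' (hkm.mul ?_) (.of_forall fun z => ?_)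
  · exact (continuous_conj.comp_aestronglyMeasurable (Lp.memLp f).1.comp_fst).mul
      (Lp.memLp g).1.comp_snd
  · simp only [norm_mul, RCLike.norm_conj, Pi.add_apply]
    nlinarith [mul_nonneg (norm_nonneg (k (z.1 - z.2))) (sq_nonneg (‖f z.1‖ - ‖g z.2‖)),
      mul_nonneg (norm_nonneg (k (z.1 - z.2))) (sq_nonneg (‖f z.1‖)),
      mul_nonneg (norm_nonneg (k (z.1 - z.2))) (sq_nonneg (‖g z.2‖))]

lemma IsFourier.integral_mul_norm_sq_of_integrable {F : L2 ≃ₗᵢ[ℂ] L2} (hF : IsFourier F)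
    {ρ : ℝ → ℝ} (hρ : Integrable ρ) (f : L2) (hf : Integrable f) :
    ((∫ p, ρ p * ‖F f p‖ ^ 2 : ℝ) : ℂ)
      = ∫ z : ℝ × ℝ, multiplierKernel ρ (z.1 - z.2) * (conj (f z.1) * f z.2) := by
  have hff : Integrable (fun z : ℝ × ℝ => conj (f z.1) * f z.2) :=
    Integrable.mul_prod (f := fun x => conj (f x))
      (conjCLE.toContinuousLinearMap.integrable_comp hf) hf
  have hint : Integrable (fun w : ℝ × (ℝ × ℝ) => exp (I * w.1 * (w.2.1 - w.2.2)) *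
      ((ρ w.1 : ℂ) * (conj (f w.2.1) * f w.2.2))) := by
    refine (Integrable.mul_prod (f := fun p => (ρ p : ℂ)) hρ.ofReal hff).bdd_mul (c := 1)
      (by fun_prop) (.of_forall fun w => ?_)
    rw [norm_exp]; simp
  have hsq : ((((2 * π) ^ (-(1:ℝ)/2) : ℝ) : ℂ)) * (((2 * π) ^ (-(1:ℝ)/2) : ℝ) : ℂ)
      = (2 * π : ℂ)⁻¹ := by
    rw [← ofReal_mul, ← rpow_add (by positivity), show -(1:ℝ)/2 + -(1:ℝ)/2 = -1 by norm_num,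
      rpow_neg_one]
    push_cast; rfl
  rw [← integral_complex_ofReal]
  have h1 : ∀ᵐ p, ((ρ p * ‖F f p‖ ^ 2 : ℝ) : ℂ) = (2 * π : ℂ)⁻¹ *
      ∫ z : ℝ × ℝ, exp (I * p * (z.1 - z.2)) * ((ρ p : ℂ) * (conj (f z.1) * f z.2)) := by
    filter_upwards [hF f hf] with p hp
    have h2 : (∫ z : ℝ × ℝ, exp (I * p * (z.1 - z.2)) * ((ρ p : ℂ) * (conj (f z.1) * f z.2)))
        = (ρ p : ℂ) * (conj (∫ q : ℝ, exp (-I * p * q) * f q) *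
          ∫ q : ℝ, exp (-I * p * q) * f q) := by
      rw [← integral_conj, ← integral_prod_mul, ← integral_const_mul]
      congr 1; ext z
      rw [map_mul, ← exp_conj]
      have : exp (I * p * (z.1 - z.2))
          = exp (conj (-I * p * z.1)) * exp (-I * p * z.2) := by
        rw [← Complex.exp_add]; congr 1; simp; ring
      rw [this]; ring
    rw [h2, ← hsq]
    push_cast
    rw [← conj_mul', hp, map_mul, conj_ofReal]
    ring
  rw [integral_congr_ae h1, integral_const_mul]
  rw [integral_integral_swap hint, ← integral_const_mul]
  congr 1; ext z
  rw [multiplierKernel, mul_assoc, ← integral_mul_const]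
  congr 2; ext p
  push_cast; ring

lemma IsFourier.integral_mul_norm_sq {F : L2 ≃ₗᵢ[ℂ] L2} (hF : IsFourier F)
    {ρ : ℝ → ℝ} (hρ : Integrable ρ) {C : ℝ} (hC : ∀ p, ‖ρ p‖ ≤ C)
    (hk : Integrable (multiplierKernel ρ)) (f : L2) :
    ((∫ p, ρ p * ‖F f p‖ ^ 2 : ℝ) : ℂ)
      = ∫ z : ℝ × ℝ, multiplierKernel ρ (z.1 - z.2) * (conj (f z.1) * f z.2) := by
  obtain ⟨g, hgi, hge, hgt⟩ := exists_truncation f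
  obtain ⟨T, hT⟩ := exists_isMulOp (g := fun p => (ρ p : ℂ)) hρ.ofReal.1 C
    (fun p => by simpa using hC p)
  have hinner : ∀ u : L2, ((∫ p, ρ p * ‖u p‖ ^ 2 : ℝ) : ℂ) = ⟪u, T u⟫_ℂ := fun u => by
    rw [L2.inner_def, ← integral_complex_ofReal]
    refine integral_congr_ae ?_
    filter_upwards [hT u] with p hp
    rw [hp, RCLike.inner_apply']
    push_cast
    rw [← conj_mul']; ring
  have hL : Tendsto (fun n => ((∫ p, ρ p * ‖F (g n) p‖ ^ 2 : ℝ) : ℂ)) atTop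
      (𝓝 ((∫ p, ρ p * ‖F f p‖ ^ 2 : ℝ) : ℂ)) := by
    simp_rw [hinner]
    have : Continuous fun u : L2 => ⟪F u, T (F u)⟫_ℂ :=
      F.continuous.inner (T.continuous.comp F.continuous)
    exact (this.tendsto f).comp hgt
  refine tendsto_nhds_unique hL ?_
  simp_rw [fun n => hF.integral_mul_norm_sq_of_integrable hρ (g n) (hgi n)]
  have hge1 : ∀ n, ∀ᵐ z : ℝ × ℝ, g n z.1 = (Icc (-(n : ℝ)) n).indicator f z.1 :=
    fun n => Measure.quasiMeasurePreserving_fst.ae (hge n)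
  have hge2 : ∀ n, ∀ᵐ z : ℝ × ℝ, g n z.2 = (Icc (-(n : ℝ)) n).indicator f z.2 :=
    fun n => Measure.quasiMeasurePreserving_snd.ae (hge n)
  refine tendsto_integral_of_dominated_convergence
    (fun z => ‖multiplierKernel ρ (z.1 - z.2) * (conj (f z.1) * f z.2)‖)
    (fun n => (integrable_kernel_mul hk (g n) (g n)).1) (integrable_kernel_mul hk f f).norm ?_ ?_
  · intro n
    filter_upwards [hge1 n, hge2 n] with z h1 h2
    simp only [norm_mul, RCLike.norm_conj]
    rw [h1, h2]
    gcongr <;> exact norm_indicator_le_norm_self _ _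
  · filter_upwards [ae_all_iff.2 hge1, ae_all_iff.2 hge2] with z h1 h2
    obtain ⟨N, hN⟩ := exists_nat_ge (max |z.1| |z.2|)
    refine tendsto_const_nhds.congr' ?_
    filter_upwards [eventually_ge_atTop N] with n hn
    have hn' : (N : ℝ) ≤ n := by exact_mod_cast hn
    have m1 : z.1 ∈ Icc (-(n : ℝ)) n := abs_le.1 ((le_max_left _ _).trans (hN.trans hn'))
    have m2 : z.2 ∈ Icc (-(n : ℝ)) n := abs_le.1 ((le_max_right _ _).trans (hN.trans hn'))
    rw [h1 n, h2 n, indicator_of_mem m1, indicator_of_mem m2]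

/-- A smooth-tailed positive-frequency cutoff, increasing to the indicator of `(0, ∞)` as
`a → 0` and `b → ∞`. -/
def cutoff (a b p : ℝ) : ℝ := (Ioi 0).indicator (fun p => rexp (-a * p) - rexp (-b * p)) p

lemma cutoff_of_pos {a b p : ℝ} (hp : 0 < p) : cutoff a b p = rexp (-a * p) - rexp (-b * p) :=
  indicator_of_mem (mem_Ioi.2 hp) _

lemma cutoff_of_nonpos {a b p : ℝ} (hp : p ≤ 0) : cutoff a b p = 0 :=
  indicator_of_notMem (by simpa using hp) _

lemma cutoff_nonneg {a b : ℝ} (hab : a ≤ b) (p : ℝ) : 0 ≤ cutoff a b p := by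
  rcases le_or_gt p 0 with hp | hp
  · rw [cutoff_of_nonpos hp]
  · rw [cutoff_of_pos hp, sub_nonneg, Real.exp_le_exp]
    nlinarith

lemma cutoff_le_one {a : ℝ} (b : ℝ) (ha : 0 ≤ a) (p : ℝ) : cutoff a b p ≤ 1 := by
  rcases le_or_gt p 0 with hp | hp
  · rw [cutoff_of_nonpos hp]; exact zero_le_one
  · rw [cutoff_of_pos hp]
    have h1 : rexp (-a * p) ≤ 1 := Real.exp_le_one_iff.2 (by nlinarith)
    have h2 := Real.exp_pos (-b * p)
    linarith

lemma integrable_cutoff {a b : ℝ} (ha : 0 < a) (hb : 0 < b) : Integrable (cutoff a b) :=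
  (integrable_indicator_iff measurableSet_Ioi).2
    ((exp_neg_integrableOn_Ioi 0 ha).sub (exp_neg_integrableOn_Ioi 0 hb))

lemma multiplierKernel_cutoff {a b : ℝ} (ha : 0 < a) (hb : 0 < b) (t : ℝ) :
    multiplierKernel (cutoff a b) t
      = (2 * π : ℂ)⁻¹ * ((a - t * I)⁻¹ - (b - t * I)⁻¹) := by
  have key : ∀ {c : ℝ}, 0 < c → ∫ p : ℝ in Ioi 0, exp ((-c + t * I) * p) = (c - t * I)⁻¹ := by
    intro c hc
    rw [integral_exp_mul_complex_Ioi (by simpa using hc)]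
    simp only [ofReal_zero, mul_zero, Complex.exp_zero]
    rw [← neg_sub, neg_div, one_div, ← inv_neg]
    congr 1; ring
  have ki : ∀ {c : ℝ}, 0 < c → IntegrableOn (fun p : ℝ => exp ((-c + t * I) * p)) (Ioi 0) :=
    fun hc => integrableOn_exp_mul_complex_Ioi (by simpa using hc) 0
  rw [multiplierKernel, ← key ha, ← key hb, ← integral_sub (ki ha) (ki hb),
    ← integral_indicator measurableSet_Ioi]
  congr 2; ext p
  by_cases hp : p ∈ Ioi (0 : ℝ)
  · rw [indicator_of_mem hp, cutoff_of_pos hp]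
    push_cast
    rw [sub_mul, ← Complex.exp_add, ← Complex.exp_add]
    congr 2 <;> ring
  · rw [indicator_of_notMem hp, cutoff_of_nonpos (by simpa using hp)]
    simp

lemma abs_le_norm_sub_mul_I (c t : ℝ) : |t| ≤ ‖(c - t * I : ℂ)‖ := by
  simpa using abs_im_le_norm (c - t * I : ℂ)

lemma norm_multiplierKernel_cutoff_le {a b : ℝ} (ha : 0 < a) (hb : 0 < b) {t : ℝ} (ht : t ≠ 0) :
    ‖multiplierKernel (cutoff a b) t‖ ≤ π⁻¹ * |t|⁻¹ := by
  have ht' : 0 < |t| := abs_pos.2 ht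
  have h : ∀ c : ℝ, ‖(c - t * I : ℂ)⁻¹‖ ≤ |t|⁻¹ := fun c => by
    rw [norm_inv]; exact inv_anti₀ ht' (abs_le_norm_sub_mul_I c t)
  rw [multiplierKernel_cutoff ha hb, norm_mul]
  have h1 : ‖(2 * π : ℂ)⁻¹‖ = (2 * π)⁻¹ := by
    rw [norm_inv, norm_mul, norm_real, Real.norm_of_nonneg pi_pos.le]; simp
  calc _ ≤ (2 * π)⁻¹ * (|t|⁻¹ + |t|⁻¹) := by
        rw [h1]; gcongr; exact (norm_sub_le _ _).trans (add_le_add (h a) (h b))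
    _ = _ := by field_simp; norm_num

lemma integrable_multiplierKernel_cutoff {a b : ℝ} (ha : 0 < a) (hb : 0 < b) :
    Integrable (multiplierKernel (cutoff a b)) := by
  have hne : ∀ {c : ℝ}, 0 < c → ∀ t : ℝ, (c - t * I : ℂ) ≠ 0 := fun {c} hc t h0 => by
    have := congrArg re h0
    simp at this; exact hc.ne' this
  have hlow : ∀ {c : ℝ}, 0 < c → ∀ t : ℝ, min c 1 ^ 2 * (1 + t ^ 2) ≤ ‖(c - t * I : ℂ)‖ ^ 2 := by
    intro c hc t
    rw [← normSq_eq_norm_sq, normSq_apply]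
    simp only [sub_re, ofReal_re, mul_re, I_re, ofReal_im, I_im, sub_im, mul_im]
    have h1 : min c 1 ^ 2 ≤ c ^ 2 := pow_le_pow_left₀ (by positivity) (min_le_left _ _) 2
    have h2 : min c 1 ^ 2 ≤ 1 ^ 2 := pow_le_pow_left₀ (by positivity) (min_le_right _ _) 2
    nlinarith [sq_nonneg t]
  have hsq : Integrable (fun t : ℝ => ((min a 1 ^ 2)⁻¹ + (min b 1 ^ 2)⁻¹) * (1 + t ^ 2)⁻¹) :=
    integrable_inv_one_add_sq.const_mul _
  have hfun : multiplierKernel (cutoff a b) = fun t : ℝ =>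
      (2 * π : ℂ)⁻¹ * (b - a) * ((a - t * I)⁻¹ * (b - t * I)⁻¹) := by
    ext t
    rw [multiplierKernel_cutoff ha hb, mul_assoc]
    congr 1
    have := hne ha t
    have := hne hb t
    field_simp
    ring
  rw [hfun]
  refine Integrable.const_mul ?_ _
  refine hsq.mono' ?_ (.of_forall fun t => ?_)
  · refine Continuous.aestronglyMeasurable ?_
    exact (Continuous.inv₀ (by fun_prop) (hne ha)).mul (Continuous.inv₀ (by fun_prop) (hne hb))
  · have ub : ∀ {c : ℝ}, 0 < c → ‖(c - t * I : ℂ)⁻¹‖ ^ 2 ≤ (min c 1 ^ 2)⁻¹ * (1 + t ^ 2)⁻¹ := by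
      intro c hc
      rw [norm_inv, inv_pow, ← mul_inv]
      have : 0 < min c 1 := by positivity
      exact inv_anti₀ (by positivity) (hlow hc t)
    rw [norm_mul]
    nlinarith [ub ha, ub hb, sq_nonneg (‖(a - t * I : ℂ)⁻¹‖ - ‖(b - t * I : ℂ)⁻¹‖)]

/-- If `F h` lives on negative frequencies and `f` is a chirp times `h`, then the part over
`x + y > 0` of the quadratic form of a positive-frequency cutoff at `f` vanishes. -/
lemma IsFourier.setIntegral_kernel_eq_zero {F : L2 ≃ₗᵢ[ℂ] L2} (hF : IsFourier F) {h f : L2}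
    (hh : ∀ᵐ p, 0 < p → F h p = 0) {c : ℝ} (hc : 0 ≤ c)
    (hf : ∀ᵐ x : ℝ, f x = exp (-I * c * x ^ 2) * h x) {a b : ℝ} (ha : 0 < a) (hb : 0 < b) :
    ∫ z : ℝ × ℝ in {z | 0 < z.1 + z.2},
      multiplierKernel (cutoff a b) (z.1 - z.2) * (conj (f z.1) * f z.2) = 0 := by
  have hS : MeasurableSet {z : ℝ × ℝ | 0 < z.1 + z.2} :=
    measurableSet_lt measurable_const (by fun_prop)
  have hi := (integrable_kernel_mul (integrable_multiplierKernel_cutoff ha hb) f f).indicator hS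
  have hmp : MeasurePreserving (fun z : ℝ × ℝ => (z.1, z.2 - z.1)) (volume.prod volume)
      (volume.prod volume) := measurePreserving_prod_sub volume volume
  rw [← integral_indicator hS, Measure.volume_eq_prod, ← hmp.map_eq,
    integral_map hmp.aemeasurable (by rw [hmp.map_eq]; exact hi.1)]
  refine (integral_prod_symm _ (hmp.integrable_comp_of_integrable hi)).trans ?_
  refine integral_eq_zero_of_ae (.of_forall fun s => ?_)
  rcases le_or_gt s 0 with hs | hs
  · refine integral_eq_zero_of_ae (.of_forall fun x => ?_)
    exact indicator_of_notMem (by simpa using hs) _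
  have hhi : Integrable (fun x => conj (h x) * h (s - x)) := by
    have := L2.integrable_inner (𝕜 := ℂ) h (reflection s h)
    refine this.congr ?_
    filter_upwards [coeFn_reflection s h] with x hx
    rw [hx, RCLike.inner_apply']
  have hint : Integrable (fun w : ℝ × ℝ => exp (I * (w.2 + c * s) * (2 * w.1 - s)) *
      ((conj (h w.1) * h (s - w.1)) * (cutoff a b w.2 : ℂ))) := by
    refine (Integrable.mul_prod hhi (integrable_cutoff ha hb).ofReal).bdd_mul (c := 1)
      (by fun_prop) (.of_forall fun w => ?_)
    rw [norm_exp]; simp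
  have h1 : ∀ᵐ x : ℝ, {z : ℝ × ℝ | 0 < z.1 + z.2}.indicator (fun z =>
      multiplierKernel (cutoff a b) (z.1 - z.2) * (conj (f z.1) * f z.2)) (x, s - x)
      = (2 * π : ℂ)⁻¹ * ∫ p : ℝ, exp (I * (p + c * s) * (2 * x - s)) *
      ((conj (h x) * h (s - x)) * (cutoff a b p : ℂ)) := by
    filter_upwards [hf, ae_sub_left s hf] with x hx hy
    rw [indicator_of_mem (by simpa using hs)]
    simp only
    rw [hx, hy, multiplierKernel, mul_assoc, ← integral_mul_const]
    congr 2; ext p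
    have e : exp (I * (p + c * s) * (2 * x - s)) = exp (I * p * (x - (s - x) : ℝ)) *
        (conj (exp (-I * c * x ^ 2)) * exp (-I * c * (s - x : ℝ) ^ 2)) := by
      rw [← exp_conj, ← Complex.exp_add, ← Complex.exp_add]
      congr 1
      simp only [map_mul, map_neg, conj_I, conj_ofReal, map_pow]
      push_cast; ring
    rw [e, map_mul]; ring
  refine (integral_congr_ae h1).trans ?_
  rw [integral_const_mul, integral_integral_swap hint]
  refine mul_eq_zero_of_right _ (integral_eq_zero_of_ae (.of_forall fun p => ?_))
  rcases le_or_gt p 0 with hp | hp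
  · simp [cutoff_of_nonpos hp]
  have hq : 0 < 2 * (p + c * s) := by positivity
  have h0 := hF.integral_conj_mul_reflection_eq_zero hh s hq
  have h2 : ∀ x : ℝ, exp (I * (p + c * s) * (2 * x - s)) *
      ((conj (h x) * h (s - x)) * (cutoff a b p : ℂ))
      = (exp (-I * (p + c * s) * s) * (cutoff a b p : ℂ)) *
        (conj (h x) * (exp (I * (2 * (p + c * s) : ℝ) * x) * h (s - x))) := fun x => by
    have e : exp (I * (p + c * s) * (2 * x - s)) = exp (-I * (p + c * s) * s) *
        exp (I * (2 * (p + c * s) : ℝ) * x) := by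
      rw [← Complex.exp_add]; congr 1; push_cast; ring
    rw [e]; ring
  simp_rw [h2]
  rw [integral_const_mul, h0, mul_zero]
  rfl

lemma lintegral_Ioc_rpow_neg_half {X : ℝ} (hX : 0 ≤ X) :
    ∫⁻ y in Ioc 0 X, ENNReal.ofReal (y ^ (-(1/2) : ℝ)) = ENNReal.ofReal (2 * X ^ (1/2 : ℝ)) := by
  have hi : IntervalIntegrable (fun y : ℝ => y ^ (-(1/2) : ℝ)) volume 0 X :=
    intervalIntegral.intervalIntegrable_rpow' (by norm_num)
  rw [← ofReal_integral_eq_lintegral_ofReal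
    ((intervalIntegrable_iff_integrableOn_Ioc_of_le hX).1 hi),
    ← intervalIntegral.integral_of_le hX, integral_rpow (Or.inl (by norm_num))]
  · congr 1
    norm_num
    ring
  · filter_upwards [ae_restrict_mem measurableSet_Ioc] with y hy
    exact rpow_nonneg hy.1.le _

lemma lintegral_Ioi_rpow {y : ℝ} (hy : 0 < y) :
    ∫⁻ x in Ioi y, ENNReal.ofReal (x ^ (-(3/2) : ℝ)) = ENNReal.ofReal (2 * y ^ (-(1/2) : ℝ)) := by
  rw [← ofReal_integral_eq_lintegral_ofReal (integrableOn_Ioi_rpow_of_lt (by norm_num) hy),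
    integral_Ioi_rpow_of_lt (by norm_num) hy]
  · congr 1
    norm_num
    ring
  · filter_upwards [ae_restrict_mem measurableSet_Ioi] with x hx
    exact rpow_nonneg (hy.trans hx).le _

/-- The sector of the second quadrant below the antidiagonal. -/
def antidiagonalSector : Set (ℝ × ℝ) := {z | 0 < z.2 ∧ z.1 + z.2 < 0}

lemma measurableSet_antidiagonalSector : MeasurableSet antidiagonalSector :=
  (measurableSet_lt measurable_const measurable_snd).inter
    (measurableSet_lt (measurable_fst.add measurable_snd) measurable_const)

lemma lintegral_antidiagonalSector_left {φ : ℝ → ENNReal} (hφ : Measurable φ) :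
    ∫⁻ z in antidiagonalSector, φ z.1 * ENNReal.ofReal ((-z.1) ^ (-(1/2) : ℝ)) *
      ENNReal.ofReal (z.2 ^ (-(1/2) : ℝ)) ≤ 2 * ∫⁻ x in Iio 0, φ x := by
  rw [← lintegral_indicator measurableSet_antidiagonalSector, Measure.volume_eq_prod,
    lintegral_prod _ ((by fun_prop : Measurable fun z : ℝ × ℝ => φ z.1 *
      ENNReal.ofReal ((-z.1) ^ (-(1/2) : ℝ)) * ENNReal.ofReal (z.2 ^ (-(1/2) : ℝ))).indicator
      measurableSet_antidiagonalSector).aemeasurable,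
    ← lintegral_const_mul _ hφ, ← lintegral_indicator measurableSet_Iio]
  refine lintegral_mono fun x => ?_
  rcases le_or_gt 0 x with hx | hx
  · refine le_of_eq_of_le ?_ zero_le
    refine (lintegral_congr fun y => ?_).trans lintegral_zero
    refine indicator_of_notMem (fun h => ?_) _
    have h1 : 0 < y := h.1
    have h2 : x + y < 0 := h.2
    linarith
  rw [indicator_of_mem (mem_Iio.2 hx)]
  calc _ ≤ ∫⁻ y in Ioc 0 (-x), φ x * ENNReal.ofReal ((-x) ^ (-(1/2) : ℝ)) *
        ENNReal.ofReal (y ^ (-(1/2) : ℝ)) := by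
        rw [← lintegral_indicator measurableSet_Ioc]
        refine lintegral_mono fun y => ?_
        by_cases h : (x, y) ∈ antidiagonalSector
        · have h1 : 0 < y := h.1
          have h2 : x + y < 0 := h.2
          rw [indicator_of_mem h, indicator_of_mem (mem_Ioc.2 ⟨h1, by linarith⟩)]
        · rw [indicator_of_notMem h]; exact zero_le
    _ = 2 * φ x := by
        rw [lintegral_const_mul _ (by fun_prop), lintegral_Ioc_rpow_neg_half (by linarith),
          mul_assoc, ← ENNReal.ofReal_mul (rpow_nonneg (by linarith) _),
          show (-x) ^ (-(1/2) : ℝ) * (2 * (-x) ^ (1/2 : ℝ)) = 2 by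
            rw [mul_left_comm, ← rpow_add (by linarith)]; norm_num]
        rw [mul_comm]; norm_num

lemma lintegral_antidiagonalSector_right {φ : ℝ → ENNReal} (hφ : Measurable φ) :
    ∫⁻ z in antidiagonalSector, φ z.2 * ENNReal.ofReal (z.2 ^ (1/2 : ℝ)) *
      ENNReal.ofReal ((-z.1) ^ (-(3/2) : ℝ)) ≤ 2 * ∫⁻ x in Ioi 0, φ x := by
  rw [← lintegral_indicator measurableSet_antidiagonalSector, Measure.volume_eq_prod,
    lintegral_prod_symm _ ((by fun_prop : Measurable fun z : ℝ × ℝ => φ z.2 *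
      ENNReal.ofReal (z.2 ^ (1/2 : ℝ)) * ENNReal.ofReal ((-z.1) ^ (-(3/2) : ℝ))).indicator
      measurableSet_antidiagonalSector).aemeasurable,
    ← lintegral_const_mul _ hφ, ← lintegral_indicator measurableSet_Ioi]
  refine lintegral_mono fun y => ?_
  rcases le_or_gt y 0 with hy | hy
  · refine le_of_eq_of_le ?_ zero_le
    refine (lintegral_congr fun x => ?_).trans lintegral_zero
    refine indicator_of_notMem (fun h => ?_) _
    have h1 : 0 < y := h.1
    linarith
  rw [indicator_of_mem (mem_Ioi.2 hy)]
  rw [← lintegral_neg_eq_self]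
  calc _ ≤ ∫⁻ x in Ioi y, φ y * ENNReal.ofReal (y ^ (1/2 : ℝ)) *
        ENNReal.ofReal (x ^ (-(3/2) : ℝ)) := by
        rw [← lintegral_indicator measurableSet_Ioi]
        refine lintegral_mono fun x => ?_
        simp only
        by_cases h : (-x, y) ∈ antidiagonalSector
        · have h2 : -x + y < 0 := h.2
          rw [indicator_of_mem h, indicator_of_mem (mem_Ioi.2 (by linarith)), neg_neg]
        · rw [indicator_of_notMem h]; exact zero_le
    _ = 2 * φ y := by
        rw [lintegral_const_mul _ (by fun_prop), lintegral_Ioi_rpow hy,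
          mul_assoc, ← ENNReal.ofReal_mul (rpow_nonneg hy.le _),
          show y ^ (1/2 : ℝ) * (2 * y ^ (-(1/2) : ℝ)) = 2 by
            rw [mul_left_comm, ← rpow_add hy]; norm_num]
        rw [mul_comm]; norm_num

lemma lintegral_kernel_antidiagonalSector_le (f : L2) :
    ∫⁻ z in antidiagonalSector, ENNReal.ofReal (π⁻¹ * |z.1 - z.2|⁻¹ * (‖f z.1‖ * ‖f z.2‖))
      ≤ ENNReal.ofReal ((∫ x in Iio 0, ‖f x‖ ^ 2) + (∫ x in Ioi 0, ‖f x‖ ^ 2) / 4) := by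
  have hfm : Measurable fun x => ‖f x‖ := (Lp.stronglyMeasurable f).norm.measurable
  have hm1 : Measurable fun x => ENNReal.ofReal (1 / 2 * ‖f x‖ ^ 2) := by fun_prop
  have hm2 : Measurable fun x => ENNReal.ofReal (1 / 8 * ‖f x‖ ^ 2) := by fun_prop
  have pt : ∀ z ∈ antidiagonalSector,
      ENNReal.ofReal (π⁻¹ * |z.1 - z.2|⁻¹ * (‖f z.1‖ * ‖f z.2‖)) ≤
      ENNReal.ofReal (1 / 2 * ‖f z.1‖ ^ 2) * ENNReal.ofReal ((-z.1) ^ (-(1/2) : ℝ)) *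
        ENNReal.ofReal (z.2 ^ (-(1/2) : ℝ)) +
      ENNReal.ofReal (1 / 8 * ‖f z.2‖ ^ 2) * ENNReal.ofReal (z.2 ^ (1/2 : ℝ)) *
        ENNReal.ofReal ((-z.1) ^ (-(3/2) : ℝ)) := by
    rintro ⟨x, y⟩ ⟨hy, hxy⟩
    simp only at hy hxy ⊢
    have hX : 0 < -x := by linarith
    rw [← ENNReal.ofReal_mul (by positivity), ← ENNReal.ofReal_mul (by positivity),
      ← ENNReal.ofReal_mul (by positivity), ← ENNReal.ofReal_mul (by positivity),
      ← ENNReal.ofReal_add (by positivity) (by positivity)]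
    refine ENNReal.ofReal_le_ofReal ?_
    have hprod : ((-x) ^ (-(1/2) : ℝ) * y ^ (-(1/2) : ℝ)) * (y ^ (1/2 : ℝ) * (-x) ^ (-(3/2) : ℝ))
        = ((-x)⁻¹) ^ 2 := by
      have e1 : (-x) ^ (-(1/2) : ℝ) * (-x) ^ (-(3/2) : ℝ) = ((-x)⁻¹) ^ 2 := by
        rw [← rpow_add hX, inv_pow, ← Real.rpow_two, ← rpow_neg hX.le]
        norm_num
      have e2 : y ^ (-(1/2) : ℝ) * y ^ (1/2 : ℝ) = 1 := by
        rw [← rpow_add hy]; norm_num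
      calc _ = ((-x) ^ (-(1/2) : ℝ) * (-x) ^ (-(3/2) : ℝ)) *
            (y ^ (-(1/2) : ℝ) * y ^ (1/2 : ℝ)) := by ring
        _ = _ := by rw [e1, e2, mul_one]
    have hpi : π⁻¹ ≤ 1 / 2 := by
      rw [one_div]; exact inv_anti₀ two_pos two_le_pi
    have hinv : |x - y|⁻¹ ≤ (-x)⁻¹ := by
      refine inv_anti₀ hX ?_
      rw [abs_of_neg (by linarith)]; linarith
    have h1 : π⁻¹ * |x - y|⁻¹ * (‖f x‖ * ‖f y‖) ≤ 1 / 2 * (-x)⁻¹ * (‖f x‖ * ‖f y‖) := by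
      gcongr
    refine h1.trans (abs_le_of_sq_le_sq' ?_ (by positivity)).2
    set A := (-x) ^ (-(1/2) : ℝ) * y ^ (-(1/2) : ℝ)
    set B := y ^ (1/2 : ℝ) * (-x) ^ (-(3/2) : ℝ)
    calc (1 / 2 * (-x)⁻¹ * (‖f x‖ * ‖f y‖)) ^ 2
        = 1 / 4 * (A * B) * (‖f x‖ ^ 2 * ‖f y‖ ^ 2) := by rw [hprod]; ring
      _ ≤ (1 / 2 * ‖f x‖ ^ 2 * A + 1 / 8 * ‖f y‖ ^ 2 * B) ^ 2 := by
        nlinarith [sq_nonneg (1 / 2 * ‖f x‖ ^ 2 * A - 1 / 8 * ‖f y‖ ^ 2 * B)]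
      _ = _ := by simp only [A, B]; ring
  have conv : ∀ (s : Set ℝ) {r : ℝ}, 0 ≤ r → ∫⁻ x in s, ENNReal.ofReal (r * ‖f x‖ ^ 2)
      = ENNReal.ofReal (r * ∫ x in s, ‖f x‖ ^ 2) := fun s r hr => by
    rw [← integral_const_mul, ofReal_integral_eq_lintegral_ofReal
      ((integrable_norm_sq f).integrableOn.const_mul r)
      (.of_forall fun x => mul_nonneg hr (sq_nonneg _))]
  calc _ ≤ _ := setLIntegral_mono' measurableSet_antidiagonalSector pt
    _ = _ := lintegral_add_left (by fun_prop) _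
    _ ≤ _ := add_le_add (lintegral_antidiagonalSector_left hm1)
        (lintegral_antidiagonalSector_right hm2)
    _ = _ := by
        have two : ∀ r : ℝ, 2 * ENNReal.ofReal r = ENNReal.ofReal (2 * r) := fun r => by
          rw [ENNReal.ofReal_mul (by norm_num)]; norm_num
        have n1 : 0 ≤ ∫ x in Iio 0, ‖f x‖ ^ 2 := integral_nonneg fun _ => sq_nonneg _
        have n2 : 0 ≤ ∫ x in Ioi 0, ‖f x‖ ^ 2 := integral_nonneg fun _ => sq_nonneg _
        rw [conv _ (by norm_num), conv _ (by norm_num), two, two,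
          ← ENNReal.ofReal_add (by positivity) (by positivity)]
        congr 1; ring

lemma ae_prod_ne_zero : ∀ᵐ z : ℝ × ℝ, z.1 ≠ 0 ∧ z.2 ≠ 0 ∧ z.1 + z.2 ≠ 0 := by
  have h : ∀ᵐ x : ℝ, x ≠ 0 := Measure.ae_ne volume 0
  have h1 : ∀ᵐ z : ℝ × ℝ, z.1 ≠ 0 := Measure.quasiMeasurePreserving_fst.ae h
  have h2 : ∀ᵐ z : ℝ × ℝ, z.2 ≠ 0 := Measure.quasiMeasurePreserving_snd.ae h
  have h3 : ∀ᵐ z : ℝ × ℝ, z.1 + z.2 ≠ 0 := by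
    have q := Measure.quasiMeasurePreserving_snd.comp
      (measurePreserving_prod_add (volume : Measure ℝ) (volume : Measure ℝ)).quasiMeasurePreserving
    exact q.ae h
  filter_upwards [h1, h2, h3] with z a b c using ⟨a, b, c⟩

lemma norm_setIntegral_kernel_cross_le {a b : ℝ} (ha : 0 < a) (hb : 0 < b) (f : L2) :
    ‖∫ z in antidiagonalSector ∪ Prod.swap ⁻¹' antidiagonalSector,
      multiplierKernel (cutoff a b) (z.1 - z.2) * (conj (f z.1) * f z.2)‖
      ≤ 2 * (∫ x in Iio 0, ‖f x‖ ^ 2) + (∫ x in Ioi 0, ‖f x‖ ^ 2) / 2 := by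
  have n1 : 0 ≤ ∫ x in Iio 0, ‖f x‖ ^ 2 := integral_nonneg fun _ => sq_nonneg _
  have n2 : 0 ≤ ∫ x in Ioi 0, ‖f x‖ ^ 2 := integral_nonneg fun _ => sq_nonneg _
  set H : ℝ × ℝ → ENNReal :=
    fun z => ENNReal.ofReal (π⁻¹ * |z.1 - z.2|⁻¹ * (‖f z.1‖ * ‖f z.2‖)) with hH
  have hswap : ∫⁻ z in Prod.swap ⁻¹' antidiagonalSector, H z = ∫⁻ z in antidiagonalSector, H z := by
    have hmp : MeasurePreserving (Prod.swap : ℝ × ℝ → ℝ × ℝ) volume volume :=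
      Measure.measurePreserving_swap
    rw [← hmp.setLIntegral_comp_preimage_emb MeasurableEquiv.prodComm.measurableEmbedding]
    refine lintegral_congr fun z => ?_
    simp only [hH, Prod.fst_swap, Prod.snd_swap]
    rw [abs_sub_comm, mul_comm ‖f z.1‖]
  have hle : ∀ z ∈ antidiagonalSector ∪ Prod.swap ⁻¹' antidiagonalSector,
      ‖multiplierKernel (cutoff a b) (z.1 - z.2) * (conj (f z.1) * f z.2)‖ₑ ≤ H z := by
    intro z hz
    rw [← ofReal_norm]
    refine ENNReal.ofReal_le_ofReal ?_
    rw [norm_mul, norm_mul, RCLike.norm_conj]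
    gcongr
    refine norm_multiplierKernel_cutoff_le ha hb (sub_ne_zero.2 fun h => ?_)
    rcases hz with ⟨h1, h2⟩ | ⟨h1, h2⟩
    · linarith
    · simp only [Prod.fst_swap, Prod.snd_swap] at h1 h2
      linarith
  have hM : MeasurableSet (antidiagonalSector ∪ Prod.swap ⁻¹' antidiagonalSector) :=
    measurableSet_antidiagonalSector.union (measurable_swap measurableSet_antidiagonalSector)
  rw [← ENNReal.ofReal_le_ofReal_iff (by positivity), ofReal_norm]
  calc _ ≤ _ := enorm_integral_le_lintegral_enorm _
    _ ≤ _ := setLIntegral_mono' hM hle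
    _ ≤ _ := lintegral_union_le _ _ _
    _ = _ := by rw [hswap]
    _ ≤ _ := add_le_add (lintegral_kernel_antidiagonalSector_le f)
      (lintegral_kernel_antidiagonalSector_le f)
    _ = _ := by
      rw [← ENNReal.ofReal_add (by positivity) (by positivity)]
      congr 1; ring

lemma integral_cutoff_mul_norm_sq_le {a b : ℝ} (ha : 0 < a) (hab : a ≤ b) (u : L2) :
    ∫ p, cutoff a b p * ‖u p‖ ^ 2 ≤ ‖u‖ ^ 2 := by
  rw [norm_sq_eq_integral]
  refine integral_mono_of_nonneg
    (.of_forall fun p => mul_nonneg (cutoff_nonneg hab p) (sq_nonneg _)) (integrable_norm_sq u)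
    (.of_forall fun p => ?_)
  exact mul_le_of_le_one_left (sq_nonneg _) (cutoff_le_one b ha.le p)

lemma IsFourier.integral_cutoff_le {F G : L2 ≃ₗᵢ[ℂ] L2} (hF : IsFourier F) (hG : IsFourier G)
    {h f : L2} (hh : ∀ᵐ p, 0 < p → G h p = 0) {c : ℝ} (hc : 0 ≤ c)
    (hf : ∀ᵐ x : ℝ, f x = exp (-I * c * x ^ 2) * h x) {a b : ℝ} (ha : 0 < a) (hab : a ≤ b) :
    ∫ p, cutoff a b p * ‖F f p‖ ^ 2
      ≤ 3 * (∫ x in Iio 0, ‖f x‖ ^ 2) + (∫ x in Ioi 0, ‖f x‖ ^ 2) / 2 := by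
  have hb : 0 < b := ha.trans_le hab
  have hkern : ∀ g : L2, _ := fun g => hF.integral_mul_norm_sq (integrable_cutoff ha hb) (C := 1)
    (fun p => by rw [Real.norm_of_nonneg (cutoff_nonneg hab p)]; exact cutoff_le_one b ha.le p)
    (integrable_multiplierKernel_cutoff ha hb) g
  have hint := integrable_kernel_mul (integrable_multiplierKernel_cutoff ha hb) f f
  set K : ℝ × ℝ → ℂ :=
    fun z => multiplierKernel (cutoff a b) (z.1 - z.2) * (conj (f z.1) * f z.2) with hK
  have hm : MemLp ((Iio 0).indicator f) 2 volume := (Lp.memLp f).indicator measurableSet_Iio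
  have hcoe := hm.coeFn_toLp
  set fm : L2 := hm.toLp _
  have hQ : MeasurableSet (Iio (0 : ℝ) ×ˢ Iio (0 : ℝ)) := measurableSet_Iio.prod measurableSet_Iio
  have hM : MeasurableSet (antidiagonalSector ∪ Prod.swap ⁻¹' antidiagonalSector) :=
    measurableSet_antidiagonalSector.union (measurable_swap measurableSet_antidiagonalSector)
  have hneg : ∫ z in Iio (0 : ℝ) ×ˢ Iio (0 : ℝ), K z
      = ((∫ p, cutoff a b p * ‖F fm p‖ ^ 2 : ℝ) : ℂ) := by
    rw [hkern, ← integral_indicator hQ]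
    refine integral_congr_ae ?_
    have e1 : ∀ᵐ z : ℝ × ℝ, fm z.1 = (Iio 0).indicator f z.1 :=
      Measure.quasiMeasurePreserving_fst.ae hcoe
    have e2 : ∀ᵐ z : ℝ × ℝ, fm z.2 = (Iio 0).indicator f z.2 :=
      Measure.quasiMeasurePreserving_snd.ae hcoe
    filter_upwards [e1, e2] with z h1 h2
    rw [h1, h2]
    by_cases m1 : z.1 ∈ Iio (0 : ℝ) <;> by_cases m2 : z.2 ∈ Iio (0 : ℝ) <;>
      simp [hK, indicator, mem_prod, m1, m2]
  have hnorm : ‖fm‖ ^ 2 = ∫ x in Iio 0, ‖f x‖ ^ 2 := by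
    rw [norm_sq_eq_integral, ← integral_indicator measurableSet_Iio]
    refine integral_congr_ae ?_
    filter_upwards [hcoe] with x hx
    rw [hx]
    by_cases m : x ∈ Iio (0 : ℝ)
    · rw [indicator_of_mem m, indicator_of_mem m]
    · rw [indicator_of_notMem m, indicator_of_notMem m]; simp
  have hS : MeasurableSet {z : ℝ × ℝ | 0 < z.1 + z.2} :=
    measurableSet_lt measurable_const (by fun_prop)
  have hset : ({z : ℝ × ℝ | 0 < z.1 + z.2}ᶜ : Set (ℝ × ℝ)) =ᵐ[volume] ((Iio 0 ×ˢ Iio 0) ∪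
      (antidiagonalSector ∪ Prod.swap ⁻¹' antidiagonalSector) : Set (ℝ × ℝ)) := by
    filter_upwards [ae_prod_ne_zero] with z ⟨h1, h2, h3⟩
    refine propext ?_
    change (¬ 0 < z.1 + z.2) ↔ ((z.1 < 0 ∧ z.2 < 0) ∨
      ((0 < z.2 ∧ z.1 + z.2 < 0) ∨ (0 < z.1 ∧ z.2 + z.1 < 0)))
    constructor
    · intro h
      have h4 : z.1 + z.2 < 0 := lt_of_le_of_ne (not_lt.1 h) h3
      rcases lt_or_gt_of_ne h1 with h5 | h5 <;> rcases lt_or_gt_of_ne h2 with h6 | h6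
      · exact Or.inl ⟨h5, h6⟩
      · exact Or.inr (Or.inl ⟨h6, h4⟩)
      · exact Or.inr (Or.inr ⟨h5, by linarith⟩)
      · linarith
    · rintro (⟨_, _⟩ | ⟨_, _⟩ | ⟨_, _⟩) <;> linarith
  have hdisj : Disjoint (Iio (0 : ℝ) ×ˢ Iio (0 : ℝ))
      (antidiagonalSector ∪ Prod.swap ⁻¹' antidiagonalSector) := by
    rw [Set.disjoint_left]
    rintro z ⟨h1, h2⟩ (⟨h3, -⟩ | ⟨h3, -⟩)
    · exact lt_asymm h2 h3
    · exact lt_asymm h1 h3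
  have hsplit : ((∫ p, cutoff a b p * ‖F f p‖ ^ 2 : ℝ) : ℂ)
      = ((∫ p, cutoff a b p * ‖F fm p‖ ^ 2 : ℝ) : ℂ) +
        ∫ z in antidiagonalSector ∪ Prod.swap ⁻¹' antidiagonalSector, K z := by
    rw [hkern, ← integral_add_compl hS hint, hG.setIntegral_kernel_eq_zero hh hc hf ha hb,
      zero_add, setIntegral_congr_set hset,
      setIntegral_union hdisj hM hint.integrableOn hint.integrableOn, hneg]
  have hre := congrArg re hsplit
  rw [add_re, ofReal_re, ofReal_re] at hre
  have hcross := (re_le_norm _).trans (norm_setIntegral_kernel_cross_le ha hb f)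
  have hmain := integral_cutoff_mul_norm_sq_le ha hab (F fm)
  rw [F.norm_map, hnorm] at hmain
  linarith

/-- If `G h` lives on negative frequencies and `f` is a chirp times `h`, then the
positive-frequency part of `f` is controlled by its restrictions to the two half-lines. -/
lemma IsFourier.setIntegral_Ioi_le {F G : L2 ≃ₗᵢ[ℂ] L2} (hF : IsFourier F) (hG : IsFourier G)
    {h f : L2} (hh : ∀ᵐ p, 0 < p → G h p = 0) {c : ℝ} (hc : 0 ≤ c)
    (hf : ∀ᵐ x : ℝ, f x = exp (-I * c * x ^ 2) * h x) :
    ∫ p in Ioi 0, ‖F f p‖ ^ 2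
      ≤ 3 * (∫ x in Iio 0, ‖f x‖ ^ 2) + (∫ x in Ioi 0, ‖f x‖ ^ 2) / 2 := by
  have hpos : ∀ n : ℕ, (0 : ℝ) < 1 / ((n : ℝ) + 1) := fun n => Nat.one_div_pos_of_nat
  have hle : ∀ n : ℕ, 1 / ((n : ℝ) + 1) ≤ (n : ℝ) + 1 := fun n => by
    rw [div_le_iff₀ (by positivity)]
    nlinarith [(Nat.cast_nonneg n : (0 : ℝ) ≤ n)]
  refine le_of_tendsto' (x := atTop)
    (f := fun n : ℕ => ∫ p, cutoff (1 / ((n : ℝ) + 1)) ((n : ℝ) + 1) p * ‖F f p‖ ^ 2) ?_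
    fun n => hF.integral_cutoff_le hG hh hc hf (hpos n) (hle n)
  rw [← integral_indicator measurableSet_Ioi]
  refine tendsto_integral_of_dominated_convergence (fun p => ‖F f p‖ ^ 2)
    (fun n => (integrable_cutoff (hpos n) ((hpos n).trans_le (hle n))).1.mul
      (integrable_norm_sq (F f)).1) (integrable_norm_sq (F f)) ?_ ?_
  · intro n
    refine .of_forall fun p => ?_
    rw [Real.norm_of_nonneg (mul_nonneg (cutoff_nonneg (hle n) p) (sq_nonneg _))]
    exact mul_le_of_le_one_left (sq_nonneg _) (cutoff_le_one _ (hpos n).le p)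
  · refine .of_forall fun p => ?_
    rcases le_or_gt p 0 with hp | hp
    · rw [indicator_of_notMem (by simpa using hp)]
      simp [cutoff_of_nonpos hp]
    · rw [indicator_of_mem (mem_Ioi.2 hp)]
      simp_rw [cutoff_of_pos hp]
      have h1 : Tendsto (fun n : ℕ => rexp (-(1 / ((n : ℝ) + 1)) * p)) atTop (𝓝 1) := by
        have : Tendsto (fun n : ℕ => -(1 / ((n : ℝ) + 1)) * p) atTop (𝓝 (-0 * p)) :=
          (tendsto_one_div_add_atTop_nhds_zero_nat (𝕜 := ℝ)).neg.mul_const p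
        simpa [Function.comp_def] using (Real.continuous_exp.tendsto _).comp this
      have h2 : Tendsto (fun n : ℕ => rexp (-((n : ℝ) + 1) * p)) atTop (𝓝 0) := by
        refine Real.tendsto_exp_atBot.comp ?_
        have : Tendsto (fun n : ℕ => ((n : ℝ) + 1) * p) atTop atTop :=
          (tendsto_atTop_add_const_right _ _ tendsto_natCast_atTop_atTop).atTop_mul_const hp
        simpa only [neg_mul, Function.comp_def] using tendsto_neg_atTop_atBot.comp this
      simpa using (h1.sub h2).mul_const (‖F f p‖ ^ 2)

lemma norm_sq_eq_setIntegral_add (f : L2) :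
    ‖f‖ ^ 2 = (∫ x in Iio 0, ‖f x‖ ^ 2) + ∫ x in Ioi 0, ‖f x‖ ^ 2 := by
  rw [norm_sq_eq_integral, ← integral_Ici_eq_integral_Ioi, ← compl_Iio,
    integral_add_compl measurableSet_Iio (integrable_norm_sq f)]

lemma norm_sub_sq_eq_setIntegral {f g : L2}
    (h : ∀ᵐ x : ℝ, g x = ((Real.sign x : ℝ) : ℂ) * f x) :
    ‖f - g‖ ^ 2 = 4 * ∫ x in Iio 0, ‖f x‖ ^ 2 := by
  rw [norm_sq_eq_integral, ← integral_const_mul, ← integral_indicator measurableSet_Iio]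
  refine integral_congr_ae ?_
  filter_upwards [Lp.coeFn_sub f g, h, Measure.ae_ne volume 0] with x h1 h2 h3
  rw [h1, Pi.sub_apply, h2]
  rcases lt_or_gt_of_ne h3 with hx | hx
  · rw [indicator_of_mem (mem_Iio.2 hx), Real.sign_of_neg hx,
      show f x - ((-1 : ℝ) : ℂ) * f x = 2 * f x by push_cast; ring, norm_mul, mul_pow]
    norm_num
  · rw [indicator_of_notMem (by simpa using hx.le), Real.sign_of_pos hx]
    simp

lemma IsMulOp.apply_apply {g g' : ℝ → ℂ} {S T : L2 →L[ℂ] L2} (hS : IsMulOp g S)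
    (hT : IsMulOp g' T) (h : ∀ᵐ x, g x * g' x = 1) (f : L2) : S (T f) = f := by
  ext1
  filter_upwards [hS (T f), hT f, h] with x h1 h2 h3
  rw [h1, h2, ← mul_assoc, h3, one_mul]

lemma ae_sign_mul_self : ∀ᵐ x : ℝ, ((Real.sign x : ℝ) : ℂ) * ((Real.sign x : ℝ) : ℂ) = 1 := by
  filter_upwards [Measure.ae_ne volume 0] with x hx
  rcases Real.sign_apply_eq_of_ne_zero x hx with h | h <;> simp [h]

lemma ae_norm_sign : ∀ᵐ x : ℝ, ‖((Real.sign x : ℝ) : ℂ)‖ = 1 := by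
  filter_upwards [Measure.ae_ne volume 0] with x hx
  rcases Real.sign_apply_eq_of_ne_zero x hx with h | h <;> simp [h]

lemma IsFourier.apply_reflection {F : L2 ≃ₗᵢ[ℂ] L2} (hF : IsFourier F) (f : L2) :
    F (reflection 0 f) = reflection 0 (F f) :=
  hF.apply_modulated_reflection 0 0 (V := .id ℂ L2) (W := .id ℂ L2)
    (by simp [IsMulOp]) (by simp [IsMulOp]) f

lemma IsMulOp.apply_reflection {g : ℝ → ℂ} {T : L2 →L[ℂ] L2} (hT : IsMulOp g T)
    (hg : ∀ x, g (-x) = g x) (f : L2) : T (reflection 0 f) = reflection 0 (T f) := by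
  ext1
  filter_upwards [hT (reflection 0 f), coeFn_reflection 0 f, coeFn_reflection 0 (T f),
    ae_sub_left 0 (hT f)] with x h1 h2 h3 h4
  rw [h1, h2, h3, h4, zero_sub, hg]

lemma IsMulOp.apply_reflection_of_odd {g : ℝ → ℂ} {T : L2 →L[ℂ] L2} (hT : IsMulOp g T)
    (hg : ∀ x, g (-x) = -g x) (f : L2) : T (reflection 0 f) = -reflection 0 (T f) := by
  ext1
  filter_upwards [hT (reflection 0 f), coeFn_reflection 0 f, coeFn_reflection 0 (T f),
    ae_sub_left 0 (hT f), Lp.coeFn_neg (reflection 0 (T f))] with x h1 h2 h3 h4 h5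
  rw [h1, h2, h5, Pi.neg_apply, h3, h4, zero_sub, hg, neg_mul, neg_neg]

lemma IsSgnP.exists_eq_comp {P : L2 →L[ℂ] L2} (hP : IsSgnP P) :
    ∃ (F : L2 ≃ₗᵢ[ℂ] L2) (S : L2 →L[ℂ] L2), IsFourier F ∧
      IsMulOp (fun p => ((Real.sign p : ℝ) : ℂ)) S ∧ ∀ f, F (P f) = S (F f) := by
  obtain ⟨F, hF, hFP⟩ := hP
  refine ⟨F, (F.toContinuousLinearEquiv : L2 →L[ℂ] L2) ∘L P ∘L
    (F.symm.toContinuousLinearEquiv : L2 →L[ℂ] L2), hF, fun ψ => ?_, fun f => ?_⟩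
  · simpa using hFP (F.symm ψ)
  · simp

lemma IsSgnP.apply_apply {P : L2 →L[ℂ] L2} (hP : IsSgnP P) (f : L2) : P (P f) = f := by
  obtain ⟨F, S, -, hS, h⟩ := hP.exists_eq_comp
  apply F.injective
  rw [h, h, hS.apply_apply hS ae_sign_mul_self]

lemma IsSgnP.norm_apply {P : L2 →L[ℂ] L2} (hP : IsSgnP P) (f : L2) : ‖P f‖ = ‖f‖ := by
  obtain ⟨F, S, -, hS, h⟩ := hP.exists_eq_comp
  rw [← F.norm_map, h, hS.norm_apply ae_norm_sign, F.norm_map]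

lemma IsSgnP.apply_reflection {P : L2 →L[ℂ] L2} (hP : IsSgnP P) (f : L2) :
    P (reflection 0 f) = -reflection 0 (P f) := by
  obtain ⟨F, S, hF, hS, h⟩ := hP.exists_eq_comp
  apply F.injective
  rw [h, hF.apply_reflection, hS.apply_reflection_of_odd (fun x => by rw [Real.sign_neg]; simp),
    map_neg, hF.apply_reflection, h]

lemma norm_chi (t q : ℝ) : ‖chi t q‖ = 1 := by
  rw [chi, show -(I / 2) * ((Real.cos t / Real.sin t : ℝ) : ℂ) * (q : ℂ) ^ 2
    = ((-(1 / 2) * (Real.cos t / Real.sin t) * q ^ 2 : ℝ) : ℂ) * I by push_cast; ring]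
  exact norm_exp_ofReal_mul_I _

lemma chi_ne_zero (t q : ℝ) : chi t q ≠ 0 := Complex.exp_ne_zero _

lemma chi_neg (t q : ℝ) : chi t (-q) = chi t q := by simp [chi]

lemma IsSgnQ.isMulOp_sign {T : L2 →L[ℂ] L2} (h : IsSgnQ 0 T) :
    IsMulOp (fun q => ((Real.sign q : ℝ) : ℂ)) T := by
  simpa [IsSgnQ] using h

lemma IsSgnQ.exists_of_sin_ne_zero {t : ℝ} {T : L2 →L[ℂ] L2} (h : IsSgnQ t T)
    (ht : Real.sin t ≠ 0) : ∃ P Mc Mci : L2 →L[ℂ] L2, IsSgnP P ∧ IsMulOp (chi t) Mc ∧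
    IsMulOp (fun q => (chi t q)⁻¹) Mci ∧ (∀ f, Mci (Mc f) = f) ∧ (∀ f, Mc (Mci f) = f) ∧
    (∀ f, ‖Mc f‖ = ‖f‖) ∧ (∀ f, ‖Mci f‖ = ‖f‖) ∧
    ∀ f, T f = ((Real.sign (Real.sin t) : ℝ) : ℂ) • Mc (P (Mci f)) := by
  rw [IsSgnQ, if_neg (by rintro rfl; simp at ht)] at h
  obtain ⟨P, Mc, Mci, hP, hMc, hMci, rfl⟩ := h
  exact ⟨P, Mc, Mci, hP, hMc, hMci,
    hMci.apply_apply hMc (.of_forall fun x => inv_mul_cancel₀ (chi_ne_zero t x)),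
    hMc.apply_apply hMci (.of_forall fun x => mul_inv_cancel₀ (chi_ne_zero t x)),
    hMc.norm_apply (.of_forall (norm_chi t)),
    hMci.norm_apply (.of_forall fun x => by rw [norm_inv, norm_chi, inv_one]), fun f => rfl⟩

lemma IsSgnQ.apply_apply {t : ℝ} {T : L2 →L[ℂ] L2} (h : IsSgnQ t T)
    (ht : t = 0 ∨ Real.sin t ≠ 0) (f : L2) : T (T f) = f := by
  rcases ht with rfl | ht
  · exact h.isMulOp_sign.apply_apply h.isMulOp_sign ae_sign_mul_self f
  · obtain ⟨P, Mc, Mci, hP, -, -, h1, h2, -, -, hT⟩ := h.exists_of_sin_ne_zero ht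
    rw [hT (T f), hT f, map_smul, map_smul, map_smul, h1, hP.apply_apply, h2, smul_smul]
    rcases Real.sign_apply_eq_of_ne_zero _ ht with h | h <;> simp [h]

lemma IsSgnQ.norm_apply {t : ℝ} {T : L2 →L[ℂ] L2} (h : IsSgnQ t T)
    (ht : t = 0 ∨ Real.sin t ≠ 0) (f : L2) : ‖T f‖ = ‖f‖ := by
  rcases ht with rfl | ht
  · exact h.isMulOp_sign.norm_apply ae_norm_sign f
  · obtain ⟨P, Mc, Mci, hP, -, -, -, -, h1, h2, hT⟩ := h.exists_of_sin_ne_zero ht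
    rw [hT, norm_smul, h1, hP.norm_apply, h2]
    rcases Real.sign_apply_eq_of_ne_zero _ ht with h | h <;> simp [h]

lemma IsSgnQ.apply_reflection {t : ℝ} {T : L2 →L[ℂ] L2} (h : IsSgnQ t T)
    (ht : t = 0 ∨ Real.sin t ≠ 0) (f : L2) : T (reflection 0 f) = -reflection 0 (T f) := by
  rcases ht with rfl | ht
  · exact h.isMulOp_sign.apply_reflection_of_odd (fun x => by rw [Real.sign_neg]; simp) f
  · obtain ⟨P, Mc, Mci, hP, hMc, hMci, -, -, -, -, hT⟩ := h.exists_of_sin_ne_zero ht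
    rw [hT, hT, hMci.apply_reflection (fun x => by rw [chi_neg]), hP.apply_reflection, map_neg,
      hMc.apply_reflection (chi_neg t), map_smul, smul_neg]

lemma sin_two_pi_div_three : Real.sin (2 * π / 3) = √3 / 2 := by
  rw [show 2 * π / 3 = π - π / 3 by ring, Real.sin_pi_sub, Real.sin_pi_div_three]

lemma cos_two_pi_div_three : Real.cos (2 * π / 3) = -(1 / 2) := by
  rw [show 2 * π / 3 = π - π / 3 by ring, Real.cos_pi_sub, Real.cos_pi_div_three]

lemma sin_four_pi_div_three : Real.sin (4 * π / 3) = -(√3 / 2) := by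
  rw [show 4 * π / 3 = π / 3 + π by ring, Real.sin_add_pi, Real.sin_pi_div_three]

lemma cos_four_pi_div_three : Real.cos (4 * π / 3) = -(1 / 2) := by
  rw [show 4 * π / 3 = π / 3 + π by ring, Real.cos_add_pi, Real.cos_pi_div_three]

lemma sin_two_pi_div_three_pos : 0 < Real.sin (2 * π / 3) := by
  rw [sin_two_pi_div_three]; positivity

lemma sin_four_pi_div_three_neg : Real.sin (4 * π / 3) < 0 := by
  rw [sin_four_pi_div_three, neg_lt_zero]; positivity

lemma chi_two_pi_div_three_inv (x : ℝ) : (chi (2 * π / 3) x)⁻¹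
    = exp (-I * ((√3)⁻¹ : ℝ) * x ^ 2) * (chi (4 * π / 3) x)⁻¹ := by
  have h3 : √3 ≠ 0 := by positivity
  have e1 : Real.cos (2 * π / 3) / Real.sin (2 * π / 3) = -(√3)⁻¹ := by
    rw [cos_two_pi_div_three, sin_two_pi_div_three]; field_simp
  have e2 : Real.cos (4 * π / 3) / Real.sin (4 * π / 3) = (√3)⁻¹ := by
    rw [cos_four_pi_div_three, sin_four_pi_div_three]; field_simp
  rw [chi, chi, e1, e2, ← Complex.exp_neg, ← Complex.exp_neg, ← Complex.exp_add]
  congr 1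
  push_cast; ring

/-- A vector cannot be simultaneously close to the `+1`-eigenspaces of all three operators. -/
lemma norm_sq_le_of_apply_eq_self {A0 A2 A4 : L2 →L[ℂ] L2} (h0 : IsSgnQ 0 A0)
    (h2 : IsSgnQ (2 * π / 3) A2) (h4 : IsSgnQ (4 * π / 3) A4) {u : L2} (hu : A4 u = u) :
    ‖u‖ ^ 2 ≤ 1 / 2 * ‖u - A2 u‖ ^ 2 + 3 / 2 * ‖u - A0 u‖ ^ 2 := by
  obtain ⟨P, Mc, Mci, hP, -, hMci, -, hinv, hnorm, hnorm', hA2⟩ :=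
    h2.exists_of_sin_ne_zero sin_two_pi_div_three_pos.ne'
  obtain ⟨P', Mc', Mci', hP', -, hMci', hinv', -, -, -, hA4⟩ :=
    h4.exists_of_sin_ne_zero sin_four_pi_div_three_neg.ne
  rw [Real.sign_of_pos sin_two_pi_div_three_pos] at hA2
  rw [Real.sign_of_neg sin_four_pi_div_three_neg] at hA4
  have hPh : P' (Mci' u) = -Mci' u := by
    have := congrArg Mci' ((hA4 u).symm.trans hu)
    rw [map_smul, hinv'] at this
    rw [eq_neg_iff_add_eq_zero]
    nth_rewrite 2 [← this]
    simp
  obtain ⟨F, hF, hFP⟩ := hP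
  obtain ⟨G, hG, hGP⟩ := hP'
  have hh : ∀ᵐ p, 0 < p → G (Mci' u) p = 0 := by
    have := hGP (Mci' u)
    rw [hPh, map_neg] at this
    filter_upwards [this, Lp.coeFn_neg (G (Mci' u))] with p h1 h2 hp
    rw [h2, Pi.neg_apply, Real.sign_of_pos hp, ofReal_one, one_mul] at h1
    exact neg_eq_self.1 h1
  have hf : ∀ᵐ x : ℝ, Mci u x = exp (-I * ((√3)⁻¹ : ℝ) * x ^ 2) * Mci' u x := by
    filter_upwards [hMci u, hMci' u] with x h1 h2
    rw [h1, h2, chi_two_pi_div_three_inv, mul_assoc]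
  have hmain := hF.setIntegral_Ioi_le hG hh (by positivity) hf
  have habs : ∀ s : Set ℝ, ∫ x in s, ‖Mci u x‖ ^ 2 = ∫ x in s, ‖u x‖ ^ 2 := fun s => by
    refine integral_congr_ae (ae_restrict_of_ae ?_)
    filter_upwards [hMci u] with x hx
    rw [hx, norm_mul, norm_inv, norm_chi, inv_one, one_mul]
  rw [habs, habs] at hmain
  have e0 := norm_sub_sq_eq_setIntegral (h0.isMulOp_sign u)
  have e2 : ‖u - A2 u‖ ^ 2 = 4 * ∫ p in Iio 0, ‖F (Mci u) p‖ ^ 2 := by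
    rw [← norm_sub_sq_eq_setIntegral (hFP (Mci u)), ← map_sub, F.norm_map,
      ← hnorm (Mci u - P (Mci u)), map_sub, hinv, hA2]
    simp
  have e3 := norm_sq_eq_setIntegral_add (F (Mci u))
  rw [F.norm_map, hnorm'] at e3
  have e4 := norm_sq_eq_setIntegral_add u
  have n1 : 0 ≤ ∫ x in Iio 0, ‖u x‖ ^ 2 := integral_nonneg fun _ => sq_nonneg _
  linarith

lemma norm_sq_le_of_apply_eq_neg {A0 A2 A4 : L2 →L[ℂ] L2} (h0 : IsSgnQ 0 A0)
    (h2 : IsSgnQ (2 * π / 3) A2) (h4 : IsSgnQ (4 * π / 3) A4) {u : L2} (hu : A4 u = -u) :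
    ‖u‖ ^ 2 ≤ 1 / 2 * ‖u + A2 u‖ ^ 2 + 3 / 2 * ‖u + A0 u‖ ^ 2 := by
  have key := norm_sq_le_of_apply_eq_self h0 h2 h4 (u := reflection 0 u) (by
    rw [h4.apply_reflection (.inr sin_four_pi_div_three_neg.ne), hu, map_neg, neg_neg])
  rwa [h2.apply_reflection (.inr sin_two_pi_div_three_pos.ne'), h0.apply_reflection (.inl rfl),
    sub_neg_eq_add, sub_neg_eq_add, ← map_add, ← map_add, LinearIsometry.norm_map,
    LinearIsometry.norm_map, LinearIsometry.norm_map] at key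

lemma norm_sub_apply_le {E : Type*} [NormedAddCommGroup E] [NormedSpace ℂ E] {S T : E →L[ℂ] E}
    (hS : ∀ x, S (S x) = x) (hS' : ∀ x, ‖S x‖ = ‖x‖) (x : E) :
    ‖((1 / 2 : ℂ) • (x + T x)) - S ((1 / 2 : ℂ) • (x + T x))‖ ≤ ‖S x - T x‖ := by
  have e : ((1 / 2 : ℂ) • (x + T x)) - S ((1 / 2 : ℂ) • (x + T x))
      = (1 / 2 : ℂ) • (S (S x - T x) - (S x - T x)) := by
    simp only [map_smul, map_add, map_sub, hS, ← smul_sub]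
    congr 1; abel
  rw [e, norm_smul]
  have := norm_sub_le (S (S x - T x)) (S x - T x)
  rw [hS'] at this
  rw [show ‖(1 / 2 : ℂ)‖ = 1 / 2 by norm_num]
  linarith

lemma norm_add_apply_le {E : Type*} [NormedAddCommGroup E] [NormedSpace ℂ E] {S T : E →L[ℂ] E}
    (hS : ∀ x, S (S x) = x) (hS' : ∀ x, ‖S x‖ = ‖x‖) (x : E) :
    ‖((1 / 2 : ℂ) • (x - T x)) + S ((1 / 2 : ℂ) • (x - T x))‖ ≤ ‖S x - T x‖ := by
  rw [norm_sub_rev]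
  simpa [sub_eq_add_neg, add_comm] using
    norm_sub_apply_le (S := -S) (T := -T) (by simpa using hS) (by simpa using hS') x

lemma norm_add_add_sq {E : Type*} [NormedAddCommGroup E] [InnerProductSpace ℂ E] (a b c : E) :
    ‖a + b + c‖ ^ 2 = 3 * (‖a‖ ^ 2 + ‖b‖ ^ 2 + ‖c‖ ^ 2)
      - (‖a - b‖ ^ 2 + ‖a - c‖ ^ 2 + ‖b - c‖ ^ 2) := by
  rw [norm_add_sq (𝕜 := ℂ) (a + b) c, norm_add_sq (𝕜 := ℂ) a b, norm_sub_sq (𝕜 := ℂ) a b,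
    norm_sub_sq (𝕜 := ℂ) a c, norm_sub_sq (𝕜 := ℂ) b c, inner_add_left, map_add]
  ring

lemma norm_sgnQ_sum_apply_sq_le {A0 A2 A4 : L2 →L[ℂ] L2} (h0 : IsSgnQ 0 A0)
    (h2 : IsSgnQ (2 * π / 3) A2) (h4 : IsSgnQ (4 * π / 3) A4) (ψ : L2) :
    ‖(A0 + A2 + A4) ψ‖ ^ 2 ≤ 26 / 3 * ‖ψ‖ ^ 2 := by
  have s0 : (0 : ℝ) = 0 ∨ Real.sin 0 ≠ 0 := .inl rfl
  have s2 : 2 * π / 3 = 0 ∨ Real.sin (2 * π / 3) ≠ 0 := .inr sin_two_pi_div_three_pos.ne'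
  have s4 : 4 * π / 3 = 0 ∨ Real.sin (4 * π / 3) ≠ 0 := .inr sin_four_pi_div_three_neg.ne
  set v : L2 := (1 / 2 : ℂ) • (ψ + A4 ψ) with hv
  set w : L2 := (1 / 2 : ℂ) • (ψ - A4 ψ) with hw
  have k1 := norm_sq_le_of_apply_eq_self h0 h2 h4 (u := v) (by
    rw [hv, map_smul, map_add, h4.apply_apply s4, add_comm])
  have k2 := norm_sq_le_of_apply_eq_neg h0 h2 h4 (u := w) (by
    rw [hw, map_smul, map_sub, h4.apply_apply s4, ← smul_neg, neg_sub])
  have v0 : ‖v - A0 v‖ ≤ ‖A0 ψ - A4 ψ‖ := norm_sub_apply_le (h0.apply_apply s0) (h0.norm_apply s0) ψ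
  have v2 : ‖v - A2 v‖ ≤ ‖A2 ψ - A4 ψ‖ := norm_sub_apply_le (h2.apply_apply s2) (h2.norm_apply s2) ψ
  have w0 : ‖w + A0 w‖ ≤ ‖A0 ψ - A4 ψ‖ := norm_add_apply_le (h0.apply_apply s0) (h0.norm_apply s0) ψ
  have w2 : ‖w + A2 w‖ ≤ ‖A2 ψ - A4 ψ‖ := norm_add_apply_le (h2.apply_apply s2) (h2.norm_apply s2) ψ
  have hpar : ‖ψ‖ ^ 2 = ‖v‖ ^ 2 + ‖w‖ ^ 2 := by
    have := parallelogram_law_with_norm ℂ ψ (A4 ψ)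
    rw [h4.norm_apply s4] at this
    rw [hv, hw, norm_smul, norm_smul]
    norm_num
    linarith
  rw [add_apply, add_apply, norm_add_add_sq,
    h0.norm_apply s0, h2.norm_apply s2, h4.norm_apply s4]
  have sq : ∀ {a b : ℝ}, 0 ≤ a → a ≤ b → a ^ 2 ≤ b ^ 2 := fun ha h => pow_le_pow_left₀ ha h 2
  have := sq (norm_nonneg _) v0
  have := sq (norm_nonneg _) v2
  have := sq (norm_nonneg _) w0
  have := sq (norm_nonneg _) w2
  linarith [sq_nonneg ‖A0 ψ - A2 ψ‖, sq_nonneg ‖A2 ψ - A4 ψ‖]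

/-- With `A := sgn Q(0) + sgn Q(2π/3) + sgn Q(4π/3)` as a bounded operator
on `L²(ℝ)`, the operator norm of `A` is strictly less than `3`. -/
theorem opNorm_sgnQ_sum_lt_three (A0 A2 A4 : L2 →L[ℂ] L2)
    (h0 : IsSgnQ 0 A0) (h2 : IsSgnQ (2 * π / 3) A2) (h4 : IsSgnQ (4 * π / 3) A4) :
    ‖A0 + A2 + A4‖ < 3 := by
  refine (ContinuousLinearMap.opNorm_le_bound (M := √(26 / 3)) _ (Real.sqrt_nonneg _)
    fun ψ => ?_).trans_lt ((Real.sqrt_lt' (by norm_num)).2 (by norm_num))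
  refine (sq_le_sq₀ (norm_nonneg _) (by positivity)).1 ?_
  rw [mul_pow, Real.sq_sqrt (by norm_num)]
  exact norm_sgnQ_sum_apply_sq_le h0 h2 h4 ψ
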